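/- Baer sum via splice decomposition: let 0 → P → T₁ → Z₁ → Q → 0 and 0 → P → T₂ → Z₂ → Q → 0 be 2-extensions with middle images M₁ = im(T₁ → Z₁) and M₂ = im(T₂ → Z₂). Let T be the pushout of T₁ ← P → T₂ along the codiagonal (i.e., (T₁ ⊕ T₂)/{(i₁(p), -i₂(p))}) and Z the pullback Z₁ ×_Q Z₂. Then 0 → P → T → Z → Q → 0 is again a 2-extension, where T → Z is induced by (T₁ → Z₁) ⊕ (T₂ → Z₂). -/

import Mathlib

/-- The pullback `Z₁ ×_Q Z₂`, realized as a submodule of `Z₁ × Z₂`. -/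
def modulePullback {A : Type*} [CommRing A] {Z₁ Z₂ Q : Type*}
    [AddCommGroup Z₁] [AddCommGroup Z₂] [AddCommGroup Q]
    [Module A Z₁] [Module A Z₂] [Module A Q]
    (q₁ : Z₁ →ₗ[A] Q) (q₂ : Z₂ →ₗ[A] Q) : Submodule A (Z₁ × Z₂) :=
  LinearMap.ker (q₁.comp (LinearMap.fst A Z₁ Z₂) - q₂.comp (LinearMap.snd A Z₁ Z₂))

/-- The pushout `T = (T₁ ⊕ T₂)/{(i₁ p, -i₂ p)}` of `T₁` and `T₂` over `P`. -/
def pushoutOver {A : Type*} [CommRing A] {P T₁ T₂ : Type*}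
    [AddCommGroup P] [AddCommGroup T₁] [AddCommGroup T₂]
    [Module A P] [Module A T₁] [Module A T₂]
    (i₁ : P →ₗ[A] T₁) (i₂ : P →ₗ[A] T₂) : Type _ :=
  (T₁ × T₂) ⧸ LinearMap.range (i₁.prod (-i₂))

noncomputable instance {A : Type*} [CommRing A] {P T₁ T₂ : Type*}
    [AddCommGroup P] [AddCommGroup T₁] [AddCommGroup T₂]
    [Module A P] [Module A T₁] [Module A T₂]
    (i₁ : P →ₗ[A] T₁) (i₂ : P →ₗ[A] T₂) : AddCommGroup (pushoutOver i₁ i₂) :=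
  inferInstanceAs (AddCommGroup ((T₁ × T₂) ⧸ LinearMap.range (i₁.prod (-i₂))))

instance {A : Type*} [CommRing A] {P T₁ T₂ : Type*}
    [AddCommGroup P] [AddCommGroup T₁] [AddCommGroup T₂]
    [Module A P] [Module A T₁] [Module A T₂]
    (i₁ : P →ₗ[A] T₁) (i₂ : P →ₗ[A] T₂) : Module A (pushoutOver i₁ i₂) :=
  inferInstanceAs (Module A ((T₁ × T₂) ⧸ LinearMap.range (i₁.prod (-i₂))))

section

variable {A : Type*} [CommRing A] {P T₁ T₂ : Type*}
  [AddCommGroup P] [AddCommGroup T₁] [AddCommGroup T₂]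
  [Module A P] [Module A T₁] [Module A T₂] (i₁ : P →ₗ[A] T₁) (i₂ : P →ₗ[A] T₂)

/-- The quotient map from `T₁ × T₂` onto the pushout. -/
def pushoutOver.mkQ : T₁ × T₂ →ₗ[A] pushoutOver i₁ i₂ :=
  (LinearMap.range (i₁.prod (-i₂))).mkQ

theorem pushoutOver.mkQ_surjective : Function.Surjective (pushoutOver.mkQ i₁ i₂) :=
  Submodule.mkQ_surjective _

theorem pushoutOver.mkQ_eq_zero_iff (x : T₁ × T₂) :
    pushoutOver.mkQ i₁ i₂ x = 0 ↔ ∃ p, i₁ p = x.1 ∧ -i₂ p = x.2 := by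
  refine (Submodule.Quotient.mk_eq_zero (LinearMap.range (i₁.prod (-i₂)))).trans ?_
  simp [Prod.ext_iff]

/-- The map out of the pushout induced by a map vanishing on the antidiagonal copy of `P`. -/
def pushoutOver.lift {N : Type*} [AddCommGroup N] [Module A N] (f : T₁ × T₂ →ₗ[A] N)
    (hf : ∀ p, f (i₁ p, -i₂ p) = 0) : pushoutOver i₁ i₂ →ₗ[A] N :=
  (LinearMap.range (i₁.prod (-i₂))).liftQ f (by rintro _ ⟨p, rfl⟩; exact hf p)

end

theorem mem_modulePullback {A : Type*} [CommRing A] {Z₁ Z₂ Q : Type*}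
    [AddCommGroup Z₁] [AddCommGroup Z₂] [AddCommGroup Q]
    [Module A Z₁] [Module A Z₂] [Module A Q]
    (q₁ : Z₁ →ₗ[A] Q) (q₂ : Z₂ →ₗ[A] Q) (z : Z₁ × Z₂) :
    z ∈ modulePullback q₁ q₂ ↔ q₁ z.1 = q₂ z.2 := by
  simp [modulePullback, sub_eq_zero]

/-- Baer sum of 2-extensions: given 2-extensions `0 → P → T₁ → Z₁ → Q → 0`
and `0 → P → T₂ → Z₂ → Q → 0`, with `T` the pushout of `T₁ ← P → T₂` and
`Z = Z₁ ×_Q Z₂`, the sequence `0 → P → T → Z → Q → 0` (with `T → Z` induced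
by `(T₁ → Z₁) ⊕ (T₂ → Z₂)`) is again a 2-extension. -/
theorem statement16 {A : Type*} [CommRing A] {P T₁ Z₁ T₂ Z₂ Q : Type*}
    [AddCommGroup P] [AddCommGroup T₁] [AddCommGroup Z₁]
    [AddCommGroup T₂] [AddCommGroup Z₂] [AddCommGroup Q]
    [Module A P] [Module A T₁] [Module A Z₁] [Module A T₂] [Module A Z₂] [Module A Q]
    (i₁ : P →ₗ[A] T₁) (t₁ : T₁ →ₗ[A] Z₁) (q₁ : Z₁ →ₗ[A] Q)
    (i₂ : P →ₗ[A] T₂) (t₂ : T₂ →ₗ[A] Z₂) (q₂ : Z₂ →ₗ[A] Q)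
    -- the two 4-term sequences are exact
    (e1 : Function.Injective i₁) (e2 : Function.Exact i₁ t₁)
    (e3 : Function.Exact t₁ q₁) (e4 : Function.Surjective q₁)
    (f1 : Function.Injective i₂) (f2 : Function.Exact i₂ t₂)
    (f3 : Function.Exact t₂ q₂) (f4 : Function.Surjective q₂) :
    ∃ (ιT : P →ₗ[A] pushoutOver i₁ i₂)
      (tz : pushoutOver i₁ i₂ →ₗ[A] modulePullback q₁ q₂)
      (zq : modulePullback q₁ q₂ →ₗ[A] Q),
      (∀ p : P, ιT p = Submodule.Quotient.mk (i₁ p, 0)) ∧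
      (∀ z : T₁ × T₂,
        (tz (Submodule.Quotient.mk z) : Z₁ × Z₂) = (t₁ z.1, t₂ z.2)) ∧
      (∀ z : modulePullback q₁ q₂, zq z = q₁ (z : Z₁ × Z₂).1) ∧
      -- the 4-term sequence `0 → P → T → Z → Q → 0` is exact
      Function.Injective ιT ∧ Function.Exact ιT tz ∧
      Function.Exact tz zq ∧ Function.Surjective zq := by
  have tz_mem (x : T₁ × T₂) : t₁.prodMap t₂ x ∈ modulePullback q₁ q₂ := by
    simp [mem_modulePullback, e3.apply_apply_eq_zero, f3.apply_apply_eq_zero]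
  let tz : pushoutOver i₁ i₂ →ₗ[A] modulePullback q₁ q₂ :=
    pushoutOver.lift i₁ i₂ ((t₁.prodMap t₂).codRestrict _ tz_mem) fun p => by
      ext <;> simp [e2.apply_apply_eq_zero, f2.apply_apply_eq_zero]
  have tz_mk (x : T₁ × T₂) :
      (tz (pushoutOver.mkQ i₁ i₂ x) : Z₁ × Z₂) = (t₁ x.1, t₂ x.2) := rfl
  refine ⟨pushoutOver.mkQ i₁ i₂ ∘ₗ LinearMap.inl A T₁ T₂ ∘ₗ i₁, tz,
    q₁ ∘ₗ LinearMap.fst A Z₁ Z₂ ∘ₗ (modulePullback q₁ q₂).subtype,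
    fun _ => rfl, tz_mk, fun _ => rfl, ?_, ?_, ?_, ?_⟩
  · rw [injective_iff_map_eq_zero]
    intro p hp
    obtain ⟨p', h₁, h₂⟩ := (pushoutOver.mkQ_eq_zero_iff i₁ i₂ (i₁ p, 0)).1 hp
    have hp' : p' = 0 := (map_eq_zero_iff i₂ f1).1 (neg_eq_zero.1 h₂)
    rw [← e1 h₁, hp']
  · intro y
    obtain ⟨⟨a, b⟩, rfl⟩ := pushoutOver.mkQ_surjective i₁ i₂ y
    rw [← Submodule.coe_eq_zero, tz_mk, Prod.mk_eq_zero]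
    constructor
    · rintro ⟨ha, hb⟩
      obtain ⟨p, rfl⟩ := (e2 a).1 ha
      obtain ⟨p', rfl⟩ := (f2 b).1 hb
      refine ⟨p + p', ?_⟩
      rw [← sub_eq_zero]
      refine (map_sub (pushoutOver.mkQ i₁ i₂) (i₁ (p + p'), 0) (i₁ p, i₂ p')).symm.trans ?_
      rw [pushoutOver.mkQ_eq_zero_iff]
      exact ⟨p', by simp, by simp⟩
    · rintro ⟨p, hp⟩
      have h := tz_mk (i₁ p, 0)
      have h' := tz_mk (a, b)
      rw [← hp] at h'
      have := h'.symm.trans h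
      simpa [e2.apply_apply_eq_zero] using this
  · rintro ⟨⟨z₁, z₂⟩, hz⟩
    have hz' : q₁ z₁ = q₂ z₂ := (mem_modulePullback q₁ q₂ _).1 hz
    constructor
    · intro (h : q₁ z₁ = 0)
      obtain ⟨a, rfl⟩ := (e3 z₁).1 h
      obtain ⟨b, rfl⟩ := (f3 z₂).1 (hz'.symm.trans h)
      exact ⟨pushoutOver.mkQ i₁ i₂ (a, b), Subtype.ext (tz_mk (a, b))⟩
    · rintro ⟨y, hy⟩
      obtain ⟨x, rfl⟩ := pushoutOver.mkQ_surjective i₁ i₂ y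
      have h : t₁ x.1 = z₁ := congrArg (fun w : modulePullback q₁ q₂ => w.1.1) hy
      exact (e3 z₁).2 ⟨x.1, h⟩
  · intro q
    obtain ⟨z₁, rfl⟩ := e4 q
    obtain ⟨z₂, h⟩ := f4 (q₁ z₁)
    exact ⟨⟨(z₁, z₂), (mem_modulePullback q₁ q₂ _).2 h.symm⟩, rfl⟩
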